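/- arXiv:1612.06647 — 3 statements merged into one kernel-verified Lean document; each statement's English description precedes it below -/
import Mathlib

section
/- For all real numbers x ≥ 0 and y > 0, one has |(√x − √y)² − (x − y)²/(4y)| ≤ 3|x − y|³/(4y²). -/
/-- For all real numbers `x ≥ 0` and `y > 0`, one has
`|(√x − √y)² − (x − y)²/(4y)| ≤ 3|x − y|³/(4y²)`. -/
theorem stmt_1 (x y : ℝ) (hx : 0 ≤ x) (hy : 0 < y) :
    |(Real.sqrt x - Real.sqrt y) ^ 2 - (x - y) ^ 2 / (4 * y)|
      ≤ 3 * |x - y| ^ 3 / (4 * y ^ 2) := by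
  obtain ⟨a, ha, rfl⟩ : ∃ a : ℝ, 0 ≤ a ∧ a ^ 2 = x := ⟨√x, Real.sqrt_nonneg x, Real.sq_sqrt hx⟩
  obtain ⟨b, hb, rfl⟩ : ∃ b : ℝ, 0 < b ∧ b ^ 2 = y := ⟨√y, Real.sqrt_pos.2 hy, Real.sq_sqrt hy.le⟩
  rw [Real.sqrt_sq ha, Real.sqrt_sq hb.le]
  have hL : (a - b) ^ 2 - (a ^ 2 - b ^ 2) ^ 2 / (4 * b ^ 2)
      = -((a - b) ^ 3 * ((a + 3 * b) / (4 * b ^ 2))) := by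
    field_simp
    ring
  have hR : |a ^ 2 - b ^ 2| = |a - b| * (a + b) := by
    rw [show a ^ 2 - b ^ 2 = (a - b) * (a + b) by ring, abs_mul,
      abs_of_nonneg (by positivity : 0 ≤ a + b)]
  have key : (a + 3 * b) / (4 * b ^ 2) ≤ 3 * (a + b) ^ 3 / (4 * (b ^ 2) ^ 2) := by
    rw [div_le_div_iff₀ (by positivity) (by positivity), ← sub_nonneg,
      show 3 * (a + b) ^ 3 * (4 * b ^ 2) - (a + 3 * b) * (4 * (b ^ 2) ^ 2)
        = 4 * b ^ 2 * (3 * a ^ 3 + 9 * a ^ 2 * b + 8 * a * b ^ 2) by ring]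
    positivity
  rw [hL, abs_neg, abs_mul, abs_pow,
    abs_of_nonneg (by positivity : 0 ≤ (a + 3 * b) / (4 * b ^ 2)), hR]
  calc |a - b| ^ 3 * ((a + 3 * b) / (4 * b ^ 2))
      ≤ |a - b| ^ 3 * (3 * (a + b) ^ 3 / (4 * (b ^ 2) ^ 2)) := by gcongr
    _ = 3 * (|a - b| * (a + b)) ^ 3 / (4 * (b ^ 2) ^ 2) := by ring
end

section
/- Let c > 0, let f : [0,1] → [0,∞) be measurable, and let λ : [0,1] → ℝ be measurable with λ(t) ≥ c for all t ∈ [0,1]. If ∫₀¹ |f(t) − λ(t)|³ dt < ∞, then all three integrals below are finite and |∫₀¹ (√(f(t)) − √(λ(t)))² dt − ∫₀¹ (f(t) − λ(t))²/(4λ(t)) dt| ≤ (3/(4c²)) · ∫₀¹ |f(t) − λ(t)|³ dt. -/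
open MeasureTheory

/-- Pointwise third-order comparison of `(√x - √y)²` with its quadratic approximation. -/
theorem abs_sq_sqrt_sub_sqrt_sub_le {c x y : ℝ} (hc : 0 < c) (hx : 0 ≤ x) (hy : c ≤ y) :
    |(Real.sqrt x - Real.sqrt y) ^ 2 - (x - y) ^ 2 / (4 * y)|
      ≤ 3 / (4 * c ^ 2) * |x - y| ^ 3 := by
  have hy0 : 0 < y := hc.trans_le hy
  obtain ⟨a, ha, rfl⟩ : ∃ a : ℝ, 0 ≤ a ∧ x = a ^ 2 :=
    ⟨Real.sqrt x, Real.sqrt_nonneg x, (Real.sq_sqrt hx).symm⟩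
  obtain ⟨b, hb, rfl⟩ : ∃ b : ℝ, 0 < b ∧ y = b ^ 2 :=
    ⟨Real.sqrt y, Real.sqrt_pos.2 hy0, (Real.sq_sqrt hy0.le).symm⟩
  rw [Real.sqrt_sq ha, Real.sqrt_sq hb.le]
  have hdiff : (a - b) ^ 2 - (a ^ 2 - b ^ 2) ^ 2 / (4 * b ^ 2)
      = -((a - b) ^ 3 * ((a + 3 * b) / (4 * b ^ 2))) := by
    field_simp
    ring
  have hfac : |a ^ 2 - b ^ 2| = |a - b| * (a + b) := by
    rw [sq_sub_sq, abs_mul, abs_of_pos (by positivity : 0 < a + b), mul_comm]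
  have hcoef : (a + 3 * b) / (4 * b ^ 2) ≤ 3 / (4 * (b ^ 2) ^ 2) * (a + b) ^ 3 := by
    rw [div_mul_eq_mul_div, div_le_div_iff₀ (by positivity) (by positivity)]
    have h : (a + 3 * b) * b ^ 2 ≤ 3 * (a + b) ^ 3 := by
      have : 0 ≤ 3 * a ^ 3 + 9 * a ^ 2 * b + 8 * a * b ^ 2 := by positivity
      linarith
    have := mul_le_mul_of_nonneg_right h (by positivity : 0 ≤ 4 * b ^ 2)
    linarith
  rw [hdiff, abs_neg, abs_mul, abs_pow, abs_of_nonneg (by positivity :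
    0 ≤ (a + 3 * b) / (4 * b ^ 2)), hfac, mul_pow, mul_left_comm]
  gcongr
  refine hcoef.trans ?_
  gcongr

/-- The quadratic approximation is controlled by the third absolute power. -/
theorem sq_div_four_mul_le {c x y : ℝ} (hc : 0 < c) (hy : c ≤ y) :
    (x - y) ^ 2 / (4 * y) ≤ 1 / (4 * c) * (1 + |x - y| ^ 3) := by
  have hsq : (x - y) ^ 2 ≤ 1 + |x - y| ^ 3 := by
    rw [← sq_abs]
    rcases le_total |x - y| 1 with h | h
    · have := pow_le_one₀ (n := 2) (abs_nonneg (x - y)) h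
      have := pow_nonneg (abs_nonneg (x - y)) 3
      linarith
    · have := pow_le_pow_right₀ h (by norm_num : 2 ≤ 3)
      linarith
  rw [div_mul_eq_mul_div, one_mul]
  gcongr

/-- Let `c > 0`, `f : [0,1] → [0,∞)` measurable, and `lam : [0,1] → ℝ` measurable with
`lam t ≥ c` for all `t ∈ [0,1]`. If `∫₀¹ |f t − lam t|³ dt < ∞`, then
`∫₀¹ (√(f t) − √(lam t))² dt` and `∫₀¹ (f t − lam t)²/(4 lam t) dt` are also finite and
`|∫₀¹ (√(f t) − √(lam t))² dt − ∫₀¹ (f t − lam t)²/(4 lam t) dt|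
  ≤ (3/(4c²)) ∫₀¹ |f t − lam t|³ dt`. -/
theorem stmt_3 (c : ℝ) (hc : 0 < c) (f lam : ℝ → ℝ)
    (hf : Measurable f) (hlam : Measurable lam)
    (hf0 : ∀ t ∈ Set.Icc (0:ℝ) 1, 0 ≤ f t)
    (hlamc : ∀ t ∈ Set.Icc (0:ℝ) 1, c ≤ lam t)
    (hfin : ∫⁻ t in Set.Icc (0:ℝ) 1, ENNReal.ofReal (|f t - lam t| ^ 3) < ⊤) :
    (∫⁻ t in Set.Icc (0:ℝ) 1,
        ENNReal.ofReal ((Real.sqrt (f t) - Real.sqrt (lam t)) ^ 2) < ⊤) ∧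
    (∫⁻ t in Set.Icc (0:ℝ) 1,
        ENNReal.ofReal ((f t - lam t) ^ 2 / (4 * lam t)) < ⊤) ∧
    |(∫⁻ t in Set.Icc (0:ℝ) 1,
        ENNReal.ofReal ((Real.sqrt (f t) - Real.sqrt (lam t)) ^ 2)).toReal
      - (∫⁻ t in Set.Icc (0:ℝ) 1,
          ENNReal.ofReal ((f t - lam t) ^ 2 / (4 * lam t))).toReal|
      ≤ 3 / (4 * c ^ 2)
          * (∫⁻ t in Set.Icc (0:ℝ) 1, ENNReal.ofReal (|f t - lam t| ^ 3)).toReal := by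
  have hmem : ∀ᵐ t ∂volume.restrict (Set.Icc (0:ℝ) 1), t ∈ Set.Icc (0:ℝ) 1 :=
    ae_restrict_mem measurableSet_Icc
  have hcube : Integrable (fun t => |f t - lam t| ^ 3) (volume.restrict (Set.Icc (0:ℝ) 1)) :=
    (lintegral_ofReal_ne_top_iff_integrable (by fun_prop)
      (Filter.Eventually.of_forall fun t => by positivity)).1 hfin.ne
  have hquad0 : 0 ≤ᵐ[volume.restrict (Set.Icc (0:ℝ) 1)]
      fun t => (f t - lam t) ^ 2 / (4 * lam t) := by
    filter_upwards [hmem] with t ht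
    have := hc.trans_le (hlamc t ht)
    positivity
  have hquad : Integrable (fun t => (f t - lam t) ^ 2 / (4 * lam t))
      (volume.restrict (Set.Icc (0:ℝ) 1)) := by
    refine (((integrable_const (1:ℝ)).add hcube).const_mul (1 / (4 * c))).mono'
      (by fun_prop : Measurable _).aestronglyMeasurable ?_
    filter_upwards [hmem, hquad0] with t ht h0
    rw [Real.norm_of_nonneg h0]
    exact sq_div_four_mul_le hc (hlamc t ht)
  have hdiff : Integrable (fun t => (Real.sqrt (f t) - Real.sqrt (lam t)) ^ 2
      - (f t - lam t) ^ 2 / (4 * lam t)) (volume.restrict (Set.Icc (0:ℝ) 1)) := by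
    refine (hcube.const_mul (3 / (4 * c ^ 2))).mono'
      (by fun_prop : Measurable _).aestronglyMeasurable ?_
    filter_upwards [hmem] with t ht
    exact abs_sq_sqrt_sub_sqrt_sub_le hc (hf0 t ht) (hlamc t ht)
  have hhell : Integrable (fun t => (Real.sqrt (f t) - Real.sqrt (lam t)) ^ 2)
      (volume.restrict (Set.Icc (0:ℝ) 1)) := by
    simpa [Pi.add_def] using hdiff.add hquad
  refine ⟨hhell.lintegral_lt_top, hquad.lintegral_lt_top, ?_⟩
  rw [← integral_eq_lintegral_of_nonneg_ae
      (Filter.Eventually.of_forall fun t => by positivity) hhell.aestronglyMeasurable,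
    ← integral_eq_lintegral_of_nonneg_ae hquad0 hquad.aestronglyMeasurable,
    ← integral_eq_lintegral_of_nonneg_ae
      (Filter.Eventually.of_forall fun t => by positivity) hcube.aestronglyMeasurable,
    ← integral_sub hhell hquad, ← integral_const_mul, ← Real.norm_eq_abs]
  refine norm_integral_le_of_norm_le (hcube.const_mul _) ?_
  filter_upwards [hmem] with t ht
  exact abs_sq_sqrt_sub_sqrt_sub_le hc (hf0 t ht) (hlamc t ht)
end

section
/- Let F : [0,1] → ℝ be bounded above, let M_F be its least concave majorant, let a ∈ ℝ and t ∈ (0,1]. Suppose M_F(t) − M_F(u) > a·(t − u) for all u ∈ [0, t). Then every u ∈ [0,1] satisfying F(u) − a·u = sup_{v∈[0,1]} (F(v) − a·v) must satisfy u ≥ t. -/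
/-- The least concave majorant on `[0,1]` of a function `F : [0,1] → ℝ` bounded above:
`M_F(x) = inf { g(x) : g concave on [0,1], g ≥ F on [0,1] }`. -/
noncomputable def leastConcaveMajorant (F : ℝ → ℝ) (x : ℝ) : ℝ :=
  sInf {y : ℝ | ∃ g : ℝ → ℝ, ConcaveOn ℝ (Set.Icc 0 1) g ∧
    (∀ u ∈ Set.Icc (0:ℝ) 1, F u ≤ g u) ∧ g x = y}

theorem leastConcaveMajorant_le {F g : ℝ → ℝ} (hg : ConcaveOn ℝ (Set.Icc 0 1) g)
    (hFg : ∀ u ∈ Set.Icc (0:ℝ) 1, F u ≤ g u) {x : ℝ} (hx : x ∈ Set.Icc (0:ℝ) 1) :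
    leastConcaveMajorant F x ≤ g x := by
  refine csInf_le ⟨F x, ?_⟩ ⟨g, hg, hFg, rfl⟩
  rintro _ ⟨h, -, hFh, rfl⟩
  exact hFh x hx

theorem le_leastConcaveMajorant {F : ℝ → ℝ} (hF : BddAbove (F '' Set.Icc 0 1)) {x : ℝ}
    (hx : x ∈ Set.Icc (0:ℝ) 1) : F x ≤ leastConcaveMajorant F x := by
  obtain ⟨C, hC⟩ := hF
  refine le_csInf ⟨C, fun _ => C, concaveOn_const C (convex_Icc 0 1),
    fun u hu => hC (Set.mem_image_of_mem F hu), rfl⟩ ?_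
  rintro _ ⟨h, -, hFh, rfl⟩
  exact hFh x hx

theorem concaveOn_affine {s : Set ℝ} (hs : Convex ℝ s) (a b : ℝ) :
    ConcaveOn ℝ s fun v => a * v + b := by
  refine ⟨hs, fun x _ y _ p q _ _ hpq => le_of_eq ?_⟩
  simp only [smul_eq_mul]
  linear_combination b * hpq

theorem bddAbove_image_sub_mul {F : ℝ → ℝ} (hF : BddAbove (F '' Set.Icc 0 1)) (a : ℝ) :
    BddAbove ((fun v => F v - a * v) '' Set.Icc 0 1) := by
  obtain ⟨C, hC⟩ := hF
  refine ⟨C + |a|, ?_⟩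
  rintro _ ⟨v, hv, rfl⟩
  have hFv : F v ≤ C := hC (Set.mem_image_of_mem F hv)
  have hav : -(a * v) ≤ |a| := by
    nlinarith [neg_abs_le a, abs_nonneg a, hv.1, hv.2]
  change F v - a * v ≤ C + |a|
  linarith


/-- Switch relation: let `F : [0,1] → ℝ` be bounded above with least concave majorant
`M_F`, let `a ∈ ℝ` and `t ∈ (0,1]`. If `M_F(t) − M_F(u) > a·(t − u)` for all `u ∈ [0,t)`,
then every `u ∈ [0,1]` with `F(u) − a·u = sup_{v ∈ [0,1]} (F(v) − a·v)` satisfies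
`u ≥ t`. -/
theorem stmt_11 (F : ℝ → ℝ) (hF : BddAbove (F '' Set.Icc 0 1)) (a t : ℝ)
    (ht : t ∈ Set.Ioc (0:ℝ) 1)
    (hslope : ∀ u ∈ Set.Ico (0:ℝ) t,
      a * (t - u) < leastConcaveMajorant F t - leastConcaveMajorant F u) :
    ∀ u ∈ Set.Icc (0:ℝ) 1,
      F u - a * u = sSup ((fun v => F v - a * v) '' Set.Icc 0 1) → t ≤ u := by
  intro u hu hmax
  by_contra! hut
  have hline : ∀ v ∈ Set.Icc (0:ℝ) 1, F v ≤ a * v + (F u - a * u) := fun v hv => by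
    have hv_le : F v - a * v ≤ F u - a * u :=
      hmax ▸ le_csSup (bddAbove_image_sub_mul hF a) ⟨v, hv, rfl⟩
    linarith
  have hMt := leastConcaveMajorant_le (concaveOn_affine (convex_Icc 0 1) a (F u - a * u)) hline
    (Set.Ioc_subset_Icc_self ht)
  have hMu := le_leastConcaveMajorant hF hu
  linarith [hslope u ⟨hu.1, hut⟩]
end
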